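/- Let n ≥ 3 and τ ∈ (0, 2(n-1)/n). Let φ : ℝⁿ → ℝ be a smooth positive function such that the conformal metric g = φ⁻²g₀ is complete, i.e., every C¹ curve γ : [0,∞) → ℝⁿ with ‖γ(t)‖ → ∞ satisfies ∫₀^∞ φ(γ(t))⁻¹ ‖γ'(t)‖ dt = ∞. Suppose the modified Schouten tensor of g is nonnegative, i.e., for every x ∈ ℝⁿ and every unit vector v ∈ ℝⁿ, (n-2)·φ(x)·D²φ(x)(v,v) + (1-τ)·φ(x)·Δφ(x) − (n−1−τn/2)·‖∇φ(x)‖² ≥ 0, where D²φ is the Euclidean Hessian, Δφ the Euclidean Laplacian and ∇φ the Euclidean gradient. Then φ is constant (hence g is isometric to the Euclidean metric g₀, up to scaling). -/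

import Mathlib

open MeasureTheory Filter Set

/-- The Euclidean Hessian of `φ` at `x` evaluated at `(v, v)`. -/
noncomputable def hess2 {n : ℕ} (φ : EuclideanSpace ℝ (Fin n) → ℝ)
    (x v : EuclideanSpace ℝ (Fin n)) : ℝ :=
  fderiv ℝ (fun y => fderiv ℝ φ y v) x v

/-- The Euclidean Laplacian of `φ` at `x`. -/
noncomputable def lapl {n : ℕ} (φ : EuclideanSpace ℝ (Fin n) → ℝ)
    (x : EuclideanSpace ℝ (Fin n)) : ℝ :=
  ∑ i : Fin n, hess2 φ x (EuclideanSpace.single i 1)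

lemma norm_gradient_eq {n : ℕ} (F : EuclideanSpace ℝ (Fin n) → ℝ) (x : EuclideanSpace ℝ (Fin n)) :
    ‖gradient F x‖ = ‖fderiv ℝ F x‖ := by
  simp [gradient]

lemma sum_fderiv_single_sq {n : ℕ} (F : EuclideanSpace ℝ (Fin n) → ℝ)
    (x : EuclideanSpace ℝ (Fin n)) :
    ∑ i, (fderiv ℝ F x (EuclideanSpace.single i 1)) ^ 2 = ‖gradient F x‖ ^ 2 := by
  rw [EuclideanSpace.norm_sq_eq]
  refine Finset.sum_congr rfl fun i _ => ?_
  have h : fderiv ℝ F x (EuclideanSpace.single i 1) = gradient F x i := by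
    have := InnerProductSpace.toDual_symm_apply (𝕜 := ℝ) (x := EuclideanSpace.single i (1 : ℝ))
      (y := fderiv ℝ F x)
    rw [← this, real_inner_comm]
    simp [gradient, EuclideanSpace.inner_single_left]
  rw [h, Real.norm_eq_abs, sq_abs]

lemma sum_mul_fderiv_single {n : ℕ} (L : EuclideanSpace ℝ (Fin n) →L[ℝ] ℝ)
    (y : EuclideanSpace ℝ (Fin n)) :
    ∑ i, y i * L (EuclideanSpace.single i 1) = L y := by
  have h : y = ∑ i, y i • EuclideanSpace.single i (1 : ℝ) := by
    ext j
    simp [Finset.sum_apply, Pi.single_apply]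
  conv_rhs => rw [h]
  simp

lemma fderiv_comp_affine {n : ℕ} {F : EuclideanSpace ℝ (Fin n) → ℝ} (hF : Differentiable ℝ F)
    (a : EuclideanSpace ℝ (Fin n)) (r : ℝ) (v w : EuclideanSpace ℝ (Fin n)) :
    fderiv ℝ (fun v => F (a + r • v)) v w = r * fderiv ℝ F (a + r • v) w := by
  have h1 : HasFDerivAt (fun v : EuclideanSpace ℝ (Fin n) => a + r • v)
      (r • ContinuousLinearMap.id ℝ (EuclideanSpace ℝ (Fin n))) v :=
    ((hasFDerivAt_id v).const_smul r).const_add a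
  have h2 := (hF (a + r • v)).hasFDerivAt.comp v h1
  have h3 : fderiv ℝ (fun v => F (a + r • v)) v = _ := h2.fderiv
  rw [h3]
  simp

lemma differentiable_fderiv_apply {n : ℕ} {F : EuclideanSpace ℝ (Fin n) → ℝ}
    (hF : ContDiff ℝ 2 F) (v : EuclideanSpace ℝ (Fin n)) :
    Differentiable ℝ (fun y => fderiv ℝ F y v) := by
  have : ContDiff ℝ 1 (fun y => fderiv ℝ F y v) :=
    (hF.fderiv_right (m := 1) (by norm_num)).clm_apply contDiff_const
  exact this.differentiable (by norm_num)

lemma continuous_hess2 {n : ℕ} {F : EuclideanSpace ℝ (Fin n) → ℝ}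
    (hF : ContDiff ℝ 2 F) (v : EuclideanSpace ℝ (Fin n)) :
    Continuous (fun y => hess2 F y v) := by
  have : ContDiff ℝ 1 (fun y => fderiv ℝ F y v) :=
    (hF.fderiv_right (m := 1) (by norm_num)).clm_apply contDiff_const
  exact (this.continuous_fderiv (by norm_num)).clm_apply continuous_const

lemma hess2_comp_affine {n : ℕ} {F : EuclideanSpace ℝ (Fin n) → ℝ} (hF : ContDiff ℝ 2 F)
    (a : EuclideanSpace ℝ (Fin n)) (r : ℝ) (v w : EuclideanSpace ℝ (Fin n)) :
    hess2 (fun v => F (a + r • v)) v w = r ^ 2 * hess2 F (a + r • v) w := by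
  unfold hess2
  have h1 : (fun y => fderiv ℝ (fun v => F (a + r • v)) y w)
      = fun y => r * fderiv ℝ F (a + r • y) w := by
    funext y
    exact fderiv_comp_affine (hF.differentiable (by norm_num)) a r y w
  have hd := differentiable_fderiv_apply hF w
  have hd' : Differentiable ℝ (fun y => fderiv ℝ F (a + r • y) w) :=
    hd.comp (by fun_prop : Differentiable ℝ fun y : EuclideanSpace ℝ (Fin n) => a + r • y)
  rw [h1, fderiv_const_mul (hd' v)]
  have h2 := fderiv_comp_affine hd a r v w
  simp only [smul_apply, smul_eq_mul, h2]
  ring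

lemma lapl_comp_affine {n : ℕ} {F : EuclideanSpace ℝ (Fin n) → ℝ} (hF : ContDiff ℝ 2 F)
    (a : EuclideanSpace ℝ (Fin n)) (r : ℝ) (v : EuclideanSpace ℝ (Fin n)) :
    lapl (fun v => F (a + r • v)) v = r ^ 2 * lapl F (a + r • v) := by
  unfold lapl
  rw [Finset.mul_sum]
  exact Finset.sum_congr rfl fun i _ => hess2_comp_affine hF a r v _

/-- The Hessian of `g ∘ F` for a real function `g`. -/
lemma hess2_comp {n : ℕ} {F : EuclideanSpace ℝ (Fin n) → ℝ} (hF : ContDiff ℝ 2 F)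
    {g g' g'' : ℝ → ℝ} (hg : ∀ x, HasDerivAt g (g' (F x)) (F x))
    (hg' : ∀ x, HasDerivAt g' (g'' (F x)) (F x)) (x v : EuclideanSpace ℝ (Fin n)) :
    hess2 (fun y => g (F y)) x v
      = g'' (F x) * (fderiv ℝ F x v) ^ 2 + g' (F x) * hess2 F x v := by
  have hFd : Differentiable ℝ F := hF.differentiable (by norm_num)
  have h1 : (fun y => fderiv ℝ (fun y => g (F y)) y v) = fun y => g' (F y) * fderiv ℝ F y v := by
    funext y
    have : fderiv ℝ (fun y => g (F y)) y = _ :=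
      ((hg y).comp_hasFDerivAt y (hFd y).hasFDerivAt).fderiv
    rw [this]
    simp
  unfold hess2
  rw [h1]
  have hd := ((hg' x).comp_hasFDerivAt x (hFd x).hasFDerivAt).mul
    (differentiable_fderiv_apply hF v x).hasFDerivAt
  have : fderiv ℝ (fun y => g' (F y) * fderiv ℝ F y v) x = _ := hd.fderiv
  rw [this]
  simp
  ring

lemma hasDerivAt_max_zero_pow (k : ℕ) (s : ℝ) :
    HasDerivAt (fun s : ℝ => max 0 s ^ (k + 2)) ((k + 2) * max 0 s ^ (k + 1)) s := by
  rcases lt_trichotomy s 0 with h | rfl | h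
  · rw [max_eq_left h.le]
    have : (fun s : ℝ => max 0 s ^ (k + 2)) =ᶠ[nhds s] fun _ => 0 := by
      filter_upwards [Iio_mem_nhds h] with t ht
      rw [max_eq_left (le_of_lt ht)]
      simp
    simpa using (hasDerivAt_const s (0 : ℝ)).congr_of_eventuallyEq this
  · rw [hasDerivAt_iff_isLittleO]
    simp only [max_self, ne_eq, Nat.add_eq_zero_iff, OfNat.ofNat_ne_zero, and_false,
      not_false_eq_true, zero_pow, sub_zero, one_ne_zero, mul_zero, smul_zero]
    have h1 : (fun s : ℝ => max 0 s ^ (k + 2)) =O[nhds 0] fun s : ℝ => s ^ (k + 2) := by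
      refine Asymptotics.IsBigO.of_bound 1 (Eventually.of_forall fun t => ?_)
      rw [one_mul, norm_pow, norm_pow]
      gcongr
      rcases le_total 0 t with ht | ht
      · rw [max_eq_right ht]
      · rw [max_eq_left ht]; simp
    refine h1.trans_isLittleO ?_
    simpa using Asymptotics.isLittleO_pow_id (𝕜 := ℝ) (n := k + 2) (by omega)
  · rw [max_eq_right h.le]
    have : (fun s : ℝ => max 0 s ^ (k + 2)) =ᶠ[nhds s] fun t => t ^ (k + 2) := by
      filter_upwards [Ioi_mem_nhds h] with t ht
      rw [max_eq_right (le_of_lt ht)]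
    refine HasDerivAt.congr_of_eventuallyEq ?_ this
    simpa using hasDerivAt_pow (k + 2) s

/-- A radial cutoff function supported in the ball of radius `4` about `e`. -/
noncomputable def cutoff {n : ℕ} (e v : EuclideanSpace ℝ (Fin n)) : ℝ := max 0 (16 - ‖v - e‖ ^ 2)

lemma cutoff_nonneg {n : ℕ} (e v : EuclideanSpace ℝ (Fin n)) : 0 ≤ cutoff e v := le_max_left _ _

lemma cutoff_le {n : ℕ} (e v : EuclideanSpace ℝ (Fin n)) : cutoff e v ≤ 16 :=
  max_le (by norm_num) (by nlinarith [sq_nonneg ‖v - e‖])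

lemma cutoff_eq_zero {n : ℕ} {e v : EuclideanSpace ℝ (Fin n)} (h : 4 ≤ ‖v - e‖) :
    cutoff e v = 0 :=
  max_eq_left (by nlinarith)

lemma continuous_cutoff {n : ℕ} (e : EuclideanSpace ℝ (Fin n)) : Continuous (cutoff e) := by
  unfold cutoff
  fun_prop

lemma hasCompactSupport_cutoff {n : ℕ} (e : EuclideanSpace ℝ (Fin n)) :
    HasCompactSupport (cutoff e) := by
  refine HasCompactSupport.intro (isCompact_closedBall e 4) fun v hv => cutoff_eq_zero ?_
  rw [Metric.mem_closedBall, dist_eq_norm, not_le] at hv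
  exact hv.le

lemma integrable_cutoff_pow_mul {n : ℕ} (e : EuclideanSpace ℝ (Fin n)) {k : ℕ} (hk : k ≠ 0)
    {F : EuclideanSpace ℝ (Fin n) → ℝ} (hF : Continuous F) :
    Integrable (fun v => cutoff e v ^ k * F v) := by
  refine Continuous.integrable_of_hasCompactSupport ?_ ?_
  · exact ((continuous_cutoff e).pow k).mul hF
  · exact ((hasCompactSupport_cutoff e).comp_left (g := fun s => s ^ k) (by simp [hk])).mul_right

lemma hasFDerivAt_cutoff_pow {n : ℕ} (k : ℕ) (e v : EuclideanSpace ℝ (Fin n)) :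
    HasFDerivAt (fun v => cutoff e v ^ (k + 2))
      (((k + 2) * cutoff e v ^ (k + 1)) •
        (-((2 : ℝ) • innerSL ℝ (v - e)) : EuclideanSpace ℝ (Fin n) →L[ℝ] ℝ)) v := by
  have h1 : HasFDerivAt (fun v : EuclideanSpace ℝ (Fin n) => 16 - ‖v - e‖ ^ 2)
      (-((2 : ℝ) • innerSL ℝ (v - e)) : EuclideanSpace ℝ (Fin n) →L[ℝ] ℝ) v := by
    have := ((hasStrictFDerivAt_norm_sq (v - e)).hasFDerivAt.comp v
      ((hasFDerivAt_id v).sub_const e)).const_sub 16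
    simpa [ofNat_smul_eq_nsmul] using this
  exact (hasDerivAt_max_zero_pow k _).comp_hasFDerivAt v h1

lemma integral_cutoff_mul_lapl {n : ℕ} (k : ℕ) (e : EuclideanSpace ℝ (Fin n))
    {U : EuclideanSpace ℝ (Fin n) → ℝ} (hU : ContDiff ℝ 2 U) :
    ∫ v, cutoff e v ^ (k + 2) * lapl U v
      = 2 * (k + 2) * ∫ v, cutoff e v ^ (k + 1) * fderiv ℝ U v (v - e) := by
  have hc : ∀ w, Continuous fun v => fderiv ℝ U v w := fun w =>
    (hU.continuous_fderiv (by norm_num)).clm_apply continuous_const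
  have hcut : ∀ (i : Fin n) (v : EuclideanSpace ℝ (Fin n)),
      fderiv ℝ (fun v => cutoff e v ^ (k + 2)) v (EuclideanSpace.single i 1)
        = cutoff e v ^ (k + 1) * (-(2 * (k + 2)) * (v - e) i) := by
    intro i v
    rw [(hasFDerivAt_cutoff_pow k e v).fderiv]
    simp [EuclideanSpace.inner_single_right]
    ring
  have key : ∀ i : Fin n, ∫ v, cutoff e v ^ (k + 2) * hess2 U v (EuclideanSpace.single i 1)
      = ∫ v, cutoff e v ^ (k + 1) *
        (2 * (k + 2) * ((v - e) i * fderiv ℝ U v (EuclideanSpace.single i 1))) := by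
    intro i
    have h := integral_mul_fderiv_eq_neg_fderiv_mul_of_integrable (μ := volume)
      (f := fun v => cutoff e v ^ (k + 2))
      (g := fun v => fderiv ℝ U v (EuclideanSpace.single i 1))
      (v := EuclideanSpace.single i (1 : ℝ)) ?_ ?_ ?_ ?_ ?_
    · unfold hess2
      rw [h, ← integral_neg]
      refine integral_congr_ae (Eventually.of_forall fun v => ?_)
      simp only [hcut]
      ring
    · simp only [hcut, mul_assoc]
      refine integrable_cutoff_pow_mul e (by omega) ?_
      have := hc (EuclideanSpace.single i 1)
      fun_prop
    · exact integrable_cutoff_pow_mul e (by omega) (continuous_hess2 hU _)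
    · exact integrable_cutoff_pow_mul e (by omega) (hc _)
    · exact fun v _ => (hasFDerivAt_cutoff_pow k e v).differentiableAt
    · exact fun v _ => differentiable_fderiv_apply hU _ v
  calc ∫ v, cutoff e v ^ (k + 2) * lapl U v
      = ∑ i, ∫ v, cutoff e v ^ (k + 2) * hess2 U v (EuclideanSpace.single i 1) := by
        rw [← integral_finsetSum]
        · simp only [lapl, Finset.mul_sum]
        · exact fun i _ => integrable_cutoff_pow_mul e (by omega) (continuous_hess2 hU _)
    _ = ∫ v, ∑ i, cutoff e v ^ (k + 1) *
        (2 * (k + 2) * ((v - e) i * fderiv ℝ U v (EuclideanSpace.single i 1))) := by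
        rw [integral_finsetSum]
        · exact Finset.sum_congr rfl fun i _ => key i
        · intro i _
          refine integrable_cutoff_pow_mul e (by omega) ?_
          have := hc (EuclideanSpace.single i 1)
          fun_prop
    _ = _ := by
        rw [← integral_const_mul]
        refine integral_congr_ae (Eventually.of_forall fun v => ?_)
        simp only
        rw [← sum_mul_fderiv_single (fderiv ℝ U v) (v - e), ← Finset.mul_sum, ← Finset.mul_sum]
        ring

/-- Mean value inequality for superharmonic functions, with weight `cutoff e`. -/
lemma integral_cutoff_mul_le {n : ℕ} (e : EuclideanSpace ℝ (Fin n))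
    {U : EuclideanSpace ℝ (Fin n) → ℝ} (hU : ContDiff ℝ 2 U) (hΔ : ∀ x, lapl U x ≤ 0) :
    ∫ v, cutoff e v * U v ≤ U e * ∫ v, cutoff e v := by
  have hI : ∀ {F : EuclideanSpace ℝ (Fin n) → ℝ}, Continuous F →
      Integrable fun v => cutoff e v * F v := fun hF => by
    simpa using integrable_cutoff_pow_mul e one_ne_zero hF
  have hcont : Continuous fun z : ℝ × EuclideanSpace ℝ (Fin n) =>
      fderiv ℝ U (e + z.1 • (z.2 - e)) (z.2 - e) := by
    have := hU.continuous_fderiv (by norm_num)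
    exact (this.comp (by fun_prop)).clm_apply (by fun_prop)
  have hslice : ∀ r ∈ Ioc (0 : ℝ) 1,
      ∫ v, cutoff e v * fderiv ℝ U (e + r • (v - e)) (v - e) ≤ 0 := by
    intro r hr
    have hW : ContDiff ℝ 2 fun v => U ((1 - r) • e + r • v) := hU.comp (by fun_prop)
    have h := integral_cutoff_mul_lapl 0 e hW
    have h0 : ∫ v, cutoff e v ^ (0 + 2) * lapl (fun v => U ((1 - r) • e + r • v)) v ≤ 0 := by
      refine integral_nonpos fun v => mul_nonpos_of_nonneg_of_nonpos (pow_nonneg (cutoff_nonneg e v) _) ?_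
      rw [lapl_comp_affine hU]
      exact mul_nonpos_of_nonneg_of_nonpos (by positivity) (hΔ _)
    have h1 : ∫ v, cutoff e v ^ (0 + 1) * fderiv ℝ (fun v => U ((1 - r) • e + r • v)) v (v - e)
        = r * ∫ v, cutoff e v * fderiv ℝ U (e + r • (v - e)) (v - e) := by
      rw [← integral_const_mul]
      refine integral_congr_ae (Eventually.of_forall fun v => ?_)
      simp only
      rw [fderiv_comp_affine (hU.differentiable (by norm_num)),
        show (1 - r) • e + r • v = e + r • (v - e) by module]
      ring
    rw [h, h1] at h0
    have := hr.1
    push_cast at h0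
    by_contra! hcon
    have : 0 < r * ∫ v, cutoff e v * fderiv ℝ U (e + r • (v - e)) (v - e) := by positivity
    linarith
  have hFTC : ∀ v, cutoff e v * U v - cutoff e v * U e
      = ∫ r in Ioc (0 : ℝ) 1, cutoff e v * fderiv ℝ U (e + r • (v - e)) (v - e) := by
    intro v
    rw [integral_const_mul, ← intervalIntegral.integral_of_le zero_le_one,
      intervalIntegral.integral_eq_sub_of_hasDerivAt (f := fun r => U (e + r • (v - e)))]
    · simp [mul_sub]
    · intro r _
      have h1 : HasDerivAt (fun r : ℝ => e + r • (v - e)) (v - e) r := by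
        simpa using ((hasDerivAt_id r).smul_const (v - e)).const_add e
      exact (hU.differentiable (by norm_num) _).hasFDerivAt.comp_hasDerivAt r h1
    · exact (hcont.comp (by fun_prop : Continuous fun r : ℝ => (r, v))).intervalIntegrable _ _
  have hsub : ∫ v, (cutoff e v * U v - cutoff e v * U e) ≤ 0 := by
    simp_rw [hFTC]
    rw [integral_integral_swap]
    · exact setIntegral_nonpos measurableSet_Ioc hslice
    · have hcont' : Continuous fun z : EuclideanSpace ℝ (Fin n) × ℝ =>
          cutoff e z.1 * fderiv ℝ U (e + z.2 • (z.1 - e)) (z.1 - e) :=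
        ((continuous_cutoff e).comp continuous_fst).mul (hcont.comp continuous_swap)
      have hK : IsCompact (Metric.closedBall e 4 ×ˢ Icc (0 : ℝ) 1) :=
        (isCompact_closedBall e 4).prod isCompact_Icc
      have hon := hcont'.continuousOn.integrableOn_compact (μ := volume.prod volume) hK
      have hon' : IntegrableOn (fun z : EuclideanSpace ℝ (Fin n) × ℝ =>
          cutoff e z.1 * fderiv ℝ U (e + z.2 • (z.1 - e)) (z.1 - e))
          (univ ×ˢ Ioc (0 : ℝ) 1) (volume.prod volume) := by
        refine hon.of_forall_sdiff_eq_zero (MeasurableSet.univ.prod measurableSet_Ioc) ?_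
        rintro ⟨v, r⟩ ⟨h1, h2⟩
        have : v ∉ Metric.closedBall e 4 := fun hv => h2 ⟨hv, Ioc_subset_Icc_self h1.2⟩
        rw [Metric.mem_closedBall, dist_eq_norm, not_le] at this
        simp [cutoff_eq_zero this.le]
      rw [IntegrableOn, ← Measure.prod_restrict, Measure.restrict_univ] at hon'
      exact hon'
  rw [integral_sub (hI hU.continuous) (hI continuous_const), integral_mul_const] at hsub
  linarith

/-- Interior estimate on the unit ball for `U > 0` with `U ΔU + |∇U|² ≤ 0`. -/
lemma setIntegral_add_norm_fderiv_le {n : ℕ} {e : EuclideanSpace ℝ (Fin n)} (he : ‖e‖ = 1)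
    {U : EuclideanSpace ℝ (Fin n) → ℝ} (hU : ContDiff ℝ 2 U) (hpos : ∀ x, 0 < U x)
    (hΔ : ∀ x, lapl U x * U x + ‖fderiv ℝ U x‖ ^ 2 ≤ 0) :
    ∫ v in Metric.closedBall 0 1, (U v + ‖fderiv ℝ U v‖)
      ≤ 400 * volume.real (Metric.closedBall (0 : EuclideanSpace ℝ (Fin n)) 5) * U e := by
  have hΔ' : ∀ x, lapl U x ≤ 0 := fun x => by
    by_contra! h
    have := mul_pos h (hpos x)
    nlinarith [hΔ x, sq_nonneg ‖fderiv ℝ U x‖]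
  have hI1 : ∀ {F : EuclideanSpace ℝ (Fin n) → ℝ}, Continuous F →
      Integrable fun v => cutoff e v * F v := fun hF => by
    simpa using integrable_cutoff_pow_mul e one_ne_zero hF
  have hdU : Continuous (fderiv ℝ U) := hU.continuous_fderiv (by norm_num)
  have hlapl : Continuous (lapl U) := by
    unfold lapl
    exact continuous_finsetSum _ fun i _ => continuous_hess2 hU _
  have hqU := hI1 hU.continuous
  have hqN := integrable_cutoff_pow_mul e two_ne_zero hdU.norm
  have hqL := integrable_cutoff_pow_mul e three_ne_zero hlapl
  have hmean := integral_cutoff_mul_le e hU hΔ'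
  have hdiv := integral_cutoff_mul_lapl 1 e hU
  norm_num [-map_sub] at hdiv
  have hinner : Integrable fun v => cutoff e v ^ 2 * fderiv ℝ U v (v - e) :=
    integrable_cutoff_pow_mul e two_ne_zero (hdU.clm_apply (by fun_prop))
  have hlow : -(4 * ∫ v, cutoff e v ^ 2 * ‖fderiv ℝ U v‖)
      ≤ ∫ v, cutoff e v ^ 2 * fderiv ℝ U v (v - e) := by
    rw [← integral_const_mul, ← integral_neg]
    refine integral_mono (hqN.const_mul 4).neg hinner fun v => ?_
    simp only
    rcases le_or_gt 4 ‖v - e‖ with h | h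
    · simp [cutoff_eq_zero h]
    · have h1 : -(4 * ‖fderiv ℝ U v‖) ≤ fderiv ℝ U v (v - e) := by
        have h2 := (fderiv ℝ U v).le_opNorm (v - e)
        have h3 : ‖fderiv ℝ U v‖ * ‖v - e‖ ≤ ‖fderiv ℝ U v‖ * 4 := by gcongr
        have h4 := neg_abs_le (fderiv ℝ U v (v - e))
        rw [← Real.norm_eq_abs] at h4
        linarith
      nlinarith [mul_le_mul_of_nonneg_left h1 (sq_nonneg (cutoff e v))]
  have hup : 48 * ∫ v, cutoff e v ^ 2 * ‖fderiv ℝ U v‖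
      ≤ -(∫ v, cutoff e v ^ 3 * lapl U v) + 576 * ∫ v, cutoff e v * U v := by
    rw [← integral_const_mul, ← integral_const_mul, ← integral_neg]
    refine le_of_le_of_eq ?_ (integral_add hqL.neg (hqU.const_mul _))
    refine integral_mono (hqN.const_mul 48) (hqL.neg.add (hqU.const_mul _)) fun v => ?_
    simp only
    have hq := cutoff_nonneg e v
    refine le_of_mul_le_mul_right ?_ (hpos v)
    have h1 := mul_le_mul_of_nonneg_left (hΔ v) (pow_nonneg hq 3)
    have h2 := mul_nonneg hq (sq_nonneg (cutoff e v * ‖fderiv ℝ U v‖ - 24 * U v))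
    nlinarith
  have htotal : ∫ v, (cutoff e v * U v + cutoff e v ^ 2 * ‖fderiv ℝ U v‖)
      ≤ 25 * (U e * ∫ v, cutoff e v) := by
    rw [integral_add hqU hqN]
    linarith
  have hcut : ∫ v, cutoff e v ≤ 16 * volume.real
      (Metric.closedBall (0 : EuclideanSpace ℝ (Fin n)) 5) := by
    have hsupp : ∫ v, cutoff e v = ∫ v in Metric.closedBall 0 5, cutoff e v := by
      refine (setIntegral_eq_integral_of_forall_compl_eq_zero fun v hv => cutoff_eq_zero ?_).symm
      rw [Metric.mem_closedBall, dist_zero_right, not_le] at hv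
      linarith [norm_sub_norm_le v e]
    rw [hsupp]
    calc ∫ v in Metric.closedBall 0 5, cutoff e v
        ≤ ∫ v in Metric.closedBall (0 : EuclideanSpace ℝ (Fin n)) 5, (16 : ℝ) := by
          refine setIntegral_mono_on ?_ ?_ measurableSet_closedBall fun v _ => cutoff_le e v
          · exact (continuous_cutoff e).continuousOn.integrableOn_compact
              (isCompact_closedBall _ _)
          · exact continuousOn_const.integrableOn_compact (isCompact_closedBall _ _)
      _ = _ := by simp [mul_comm]
  calc ∫ v in Metric.closedBall 0 1, (U v + ‖fderiv ℝ U v‖)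
      ≤ ∫ v in Metric.closedBall 0 1, (cutoff e v * U v + cutoff e v ^ 2 * ‖fderiv ℝ U v‖) := by
        refine setIntegral_mono_on ?_ (hqU.add hqN).integrableOn measurableSet_closedBall ?_
        · exact (hU.continuous.add hdU.norm).continuousOn.integrableOn_compact
            (isCompact_closedBall _ _)
        · intro v hv
          rw [Metric.mem_closedBall, dist_zero_right] at hv
          have h1 : ‖v - e‖ ≤ 2 := (norm_sub_le v e).trans (by linarith)
          have h2 : 1 ≤ cutoff e v :=
            le_max_of_le_right (by nlinarith [norm_nonneg (v - e)])
          have h3 : 1 ≤ cutoff e v ^ 2 := one_le_pow₀ h2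
          nlinarith [mul_le_mul_of_nonneg_right h2 (hpos v).le,
            mul_le_mul_of_nonneg_right h3 (norm_nonneg (fderiv ℝ U v))]
    _ ≤ ∫ v, (cutoff e v * U v + cutoff e v ^ 2 * ‖fderiv ℝ U v‖) := by
        refine setIntegral_le_integral (hqU.add hqN) (Eventually.of_forall fun v => ?_)
        have := cutoff_nonneg e v
        have := (hpos v).le
        simp only [Pi.zero_apply]
        positivity
    _ ≤ 25 * (U e * ∫ v, cutoff e v) := htotal
    _ ≤ _ := by
        have := mul_le_mul_of_nonneg_left hcut (hpos e).le
        linarith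

lemma deriv_deriv_nonpos_of_isLocalMax {f : ℝ → ℝ} {x : ℝ} (h : IsLocalMax f x)
    (hc : ContinuousAt f x) : deriv (deriv f) x ≤ 0 := by
  by_contra! hpos
  have hmin := isLocalMin_of_deriv_deriv_pos hpos h.deriv_eq_zero hc
  have heq : f =ᶠ[nhds x] fun _ => f x := by
    filter_upwards [h, hmin] with y h1 h2 using le_antisymm h1 h2
  have h2 : deriv (deriv f) x = 0 := by
    rw [heq.deriv.deriv_eq]
    simp
  exact hpos.ne' h2

/-- First and second order conditions when `log F` is touched from above by a radial function. -/
lemma fderiv_eq_and_hess2_le_of_isLocalMax {n : ℕ} {F : EuclideanSpace ℝ (Fin n) → ℝ}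
    (hF : ContDiff ℝ 2 F) (hpos : ∀ x, 0 < F x) {G G' G'' : ℝ → ℝ}
    (hG : ∀ ρ, 0 < ρ → HasDerivAt G (G' ρ) ρ) (hG' : ∀ ρ, 0 < ρ → HasDerivAt G' (G'' ρ) ρ)
    {p x : EuclideanSpace ℝ (Fin n)} (hx : x ≠ p)
    (hmax : IsLocalMax (fun y => Real.log (F y) - G (‖y - p‖ ^ 2)) x)
    (v : EuclideanSpace ℝ (Fin n)) (hv : ‖v‖ = 1) :
    fderiv ℝ F x v = F x * (2 * G' (‖x - p‖ ^ 2) * inner ℝ (x - p) v) ∧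
    hess2 F x v ≤ F x * (4 * (G' (‖x - p‖ ^ 2) ^ 2 + G'' (‖x - p‖ ^ 2)) * inner ℝ (x - p) v ^ 2
      + 2 * G' (‖x - p‖ ^ 2)) := by
  have hFd : Differentiable ℝ F := hF.differentiable (by norm_num)
  set B := inner ℝ (x - p) v with hB
  set ρ : ℝ → ℝ := fun s => ‖x - p‖ ^ 2 + 2 * B * s + s ^ 2 with hρ
  have hline : ∀ s : ℝ, HasDerivAt (fun s : ℝ => x + s • v) v s := fun s => by
    simpa using ((hasDerivAt_id s).smul_const v).const_add x
  have hρeq : ∀ s : ℝ, ‖x + s • v - p‖ ^ 2 = ρ s := by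
    intro s
    rw [show x + s • v - p = (x - p) + s • v by abel, norm_add_sq_real, norm_smul, hv,
      real_inner_smul_right]
    simp [hρ, hB]
    ring
  have hρ' : ∀ s, HasDerivAt ρ (2 * B + 2 * s) s := fun s => by
    have := (((hasDerivAt_id s).const_mul (2 * B)).const_add (‖x - p‖ ^ 2)).add
      (hasDerivAt_pow 2 s)
    refine this.congr_deriv ?_
    simp
  have hρ0 : ρ 0 = ‖x - p‖ ^ 2 := by simp [hρ]
  have hρpos0 : 0 < ρ 0 := by
    rw [hρ0]
    have := norm_pos_iff.mpr (sub_ne_zero.mpr hx)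
    positivity
  have hρpos : ∀ᶠ s in nhds (0 : ℝ), 0 < ρ s :=
    (hρ' 0).continuousAt.eventually (lt_mem_nhds hρpos0)
  have hα : ∀ s : ℝ, HasDerivAt (fun s : ℝ => F (x + s • v)) (fderiv ℝ F (x + s • v) v) s :=
    fun s => (hFd _).hasFDerivAt.comp_hasDerivAt s (hline s)
  have hα' : HasDerivAt (fun s : ℝ => fderiv ℝ F (x + s • v) v) (hess2 F x v) 0 := by
    have := (differentiable_fderiv_apply hF v (x + (0 : ℝ) • v)).hasFDerivAt.comp_hasDerivAt 0
      (hline 0)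
    rw [zero_smul, add_zero] at this
    exact this
  set g : ℝ → ℝ := fun s => Real.log (F (x + s • v)) - G (ρ s) with hg
  have hgd : ∀ s, 0 < ρ s → HasDerivAt g
      (fderiv ℝ F (x + s • v) v / F (x + s • v) - G' (ρ s) * (2 * B + 2 * s)) s := by
    intro s hs
    exact ((hα s).log (hpos _).ne').sub ((hG _ hs).comp s (hρ' s))
  have hgmax : IsLocalMax g 0 := by
    have hc : ContinuousAt (fun s : ℝ => x + s • v) 0 := (hline 0).continuousAt
    rw [ContinuousAt, zero_smul, add_zero] at hc
    have := hc.eventually hmax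
    refine this.mono fun s hs => ?_
    simp only [hρeq] at hs
    simp only [hg, zero_smul, add_zero, hρ0]
    exact hs
  have hg0 := hgd 0 hρpos0
  have hfirst := hgmax.hasDerivAt_eq_zero hg0
  simp only [zero_smul, add_zero, mul_zero, hρ0] at hfirst
  have hFx := hpos x
  have h1 : fderiv ℝ F x v = F x * (2 * G' (‖x - p‖ ^ 2) * B) := by
    field_simp at hfirst
    linarith
  refine ⟨h1, ?_⟩
  have hderiv : deriv g =ᶠ[nhds 0] fun s =>
      fderiv ℝ F (x + s • v) v / F (x + s • v) - G' (ρ s) * (2 * B + 2 * s) := by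
    filter_upwards [hρpos] with s hs using (hgd s hs).deriv
  have hlin : HasDerivAt (fun s : ℝ => 2 * B + 2 * s) 2 0 := by
    simpa using ((hasDerivAt_id (0 : ℝ)).const_mul 2).const_add (2 * B)
  have hsecond : HasDerivAt (fun s => fderiv ℝ F (x + s • v) v / F (x + s • v)
      - G' (ρ s) * (2 * B + 2 * s)) _ 0 := (hα'.div (hα 0) (hpos _).ne').sub
    (((hG' _ hρpos0).comp 0 (hρ' 0)).mul hlin)
  have hle := deriv_deriv_nonpos_of_isLocalMax hgmax hg0.continuousAt
  rw [hderiv.deriv_eq, hsecond.deriv] at hle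
  simp only [zero_smul, add_zero, mul_zero, hρ0, Function.comp_apply, h1] at hle
  have h2 : hess2 F x v / F x ≤ 4 * (G' (‖x - p‖ ^ 2) ^ 2 + G'' (‖x - p‖ ^ 2)) * B ^ 2
      + 2 * G' (‖x - p‖ ^ 2) := by
    have h3 : (hess2 F x v * F x - F x * (2 * G' (‖x - p‖ ^ 2) * B) *
        (F x * (2 * G' (‖x - p‖ ^ 2) * B))) / F x ^ 2
        = hess2 F x v / F x - (2 * G' (‖x - p‖ ^ 2) * B) ^ 2 := by
      field_simp
    rw [h3] at hle
    linarith
  rwa [div_le_iff₀' hFx] at h2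

/-- Sharp growth of `φ` on spheres, by comparison with `A (1 + b |x - p| ^ (2γ)) ^ (1 / γ)`. -/
lemma exists_sphere_quadratic_growth {n : ℕ} (hn : 3 ≤ n) {τ : ℝ} (hτ0 : 0 < τ) (hτ1 : τ ≤ 1)
    {φ : EuclideanSpace ℝ (Fin n) → ℝ} (hφ : ContDiff ℝ 2 φ) (hpos : ∀ x, 0 < φ x)
    (hS : ∀ x v : EuclideanSpace ℝ (Fin n), ‖v‖ = 1 →
      0 ≤ (n - 2) * φ x * hess2 φ x v + (1 - τ) * φ x * lapl φ x
        - (n - 1 - τ * n / 2) * ‖gradient φ x‖ ^ 2)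
    {p q : EuclideanSpace ℝ (Fin n)} (hpq : φ p < φ q) :
    ∃ c > 0, ∀ R, ‖q - p‖ < R → ∃ x, ‖x - p‖ = R ∧ c * R ^ 2 ≤ φ x := by
  have hn' : (3 : ℝ) ≤ n := by exact_mod_cast hn
  obtain ⟨γ, hγ0, hγ⟩ : ∃ γ : ℝ, 0 < γ ∧ 4 * γ * (n - 1 - τ) < 2 * τ * (n - 2) :=
    ⟨τ / 8, by positivity, by nlinarith⟩
  have hqp : 0 < ‖q - p‖ := norm_pos_iff.mpr (sub_ne_zero.mpr fun h => by simp [h] at hpq)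
  set δ := Real.log (φ q) - Real.log (φ p) with hδ
  have hδ0 : 0 < δ := sub_pos.mpr (Real.log_lt_log (hpos p) hpq)
  set b : ℝ := γ * δ / 4 / (‖q - p‖ ^ 2) ^ γ with hb
  have hb0 : 0 < b := by positivity
  set C : ℝ := Real.log (φ p) + δ / 2 with hC
  set G : ℝ → ℝ := fun ρ => C + 1 / γ * Real.log (1 + b * ρ ^ γ) with hG
  set Z : ℝ → ℝ := fun ρ => 1 - (1 + b * ρ ^ γ)⁻¹ with hZ
  have hden : ∀ ρ : ℝ, 0 < ρ → 0 < 1 + b * ρ ^ γ := fun ρ hρ => by positivity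
  have hpow : ∀ ρ : ℝ, 0 < ρ → HasDerivAt (fun ρ => 1 + b * ρ ^ γ) (b * (γ * (ρ ^ γ / ρ))) ρ := by
    intro ρ hρ
    have := ((Real.hasDerivAt_rpow_const (p := γ) (Or.inl hρ.ne')).const_mul b).const_add 1
    rwa [Real.rpow_sub_one hρ.ne'] at this
  have hG1 : ∀ ρ, 0 < ρ → HasDerivAt G (Z ρ / ρ) ρ := by
    intro ρ hρ
    have hd := hden ρ hρ
    refine ((((hpow ρ hρ).log hd.ne').const_mul (1 / γ)).const_add C).congr_deriv ?_
    simp only [hZ]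
    field_simp
    ring
  have hZ1 : ∀ ρ, 0 < ρ → HasDerivAt Z (γ * Z ρ * (1 - Z ρ) / ρ) ρ := by
    intro ρ hρ
    have hd := hden ρ hρ
    refine (((hpow ρ hρ).inv hd.ne').const_sub 1).congr_deriv ?_
    simp only [hZ]
    field_simp
    ring
  have hG2 : ∀ ρ, 0 < ρ → HasDerivAt (fun ρ => Z ρ / ρ)
      ((γ * Z ρ * (1 - Z ρ) - Z ρ) / ρ ^ 2) ρ := by
    intro ρ hρ
    refine ((hZ1 ρ hρ).div (hasDerivAt_id ρ) hρ.ne').congr_deriv ?_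
    simp only [id]
    field_simp
  have hZpos : ∀ ρ, 0 < ρ → 0 < Z ρ ∧ Z ρ < 1 := by
    intro ρ hρ
    have h1 : 0 < b * ρ ^ γ := by positivity
    have h2 : (1 + b * ρ ^ γ)⁻¹ < 1 := inv_lt_one_of_one_lt₀ (by linarith)
    have h3 : 0 < (1 + b * ρ ^ γ)⁻¹ := inv_pos.mpr (hden ρ hρ)
    simp only [hZ]
    constructor <;> linarith
  have hno : ∀ x, x ≠ p → ¬ IsLocalMax (fun y => Real.log (φ y) - G (‖y - p‖ ^ 2)) x := by
    intro x hx hmax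
    have hnorm : 0 < ‖x - p‖ := norm_pos_iff.mpr (sub_ne_zero.mpr hx)
    set ρ := ‖x - p‖ ^ 2 with hρdef
    have hρ : 0 < ρ := by positivity
    obtain ⟨hz0, hz1⟩ := hZpos ρ hρ
    set z := Z ρ with hz
    have hcond := fderiv_eq_and_hess2_le_of_isLocalMax hφ hpos hG1 hG2 hx hmax
    rw [← hρdef] at hcond
    have hsum : ∑ i, (x - p) i ^ 2 = ρ := by
      rw [hρdef, EuclideanSpace.norm_sq_eq]
      simp
    have hin : ∀ i : Fin n, inner ℝ (x - p) (EuclideanSpace.single i (1 : ℝ)) = (x - p) i := by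
      intro i
      simp [EuclideanSpace.inner_single_right]
    have hgrad : ‖gradient φ x‖ ^ 2 = φ x ^ 2 * (4 * z ^ 2 / ρ) := by
      rw [← sum_fderiv_single_sq]
      calc ∑ i, (fderiv ℝ φ x (EuclideanSpace.single i 1)) ^ 2
          = ∑ i, (φ x * (2 * (z / ρ))) ^ 2 * (x - p) i ^ 2 := by
            refine Finset.sum_congr rfl fun i _ => ?_
            rw [(hcond (EuclideanSpace.single i 1) (by simp)).1, hin]
            ring
        _ = _ := by
            rw [← Finset.mul_sum, hsum]
            field_simp
            ring
    have hlapl : lapl φ x ≤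
        φ x * ((4 * (z ^ 2 + γ * z * (1 - z) - z) + 2 * n * z) / ρ) := by
      calc lapl φ x ≤ ∑ i, φ x * (4 * ((z / ρ) ^ 2 + (γ * z * (1 - z) - z) / ρ ^ 2)
            * (x - p) i ^ 2 + 2 * (z / ρ)) := by
            refine Finset.sum_le_sum fun i _ => ?_
            have := (hcond (EuclideanSpace.single i 1) (by simp)).2
            rwa [hin] at this
        _ = _ := by
            rw [← Finset.mul_sum, Finset.sum_add_distrib, ← Finset.mul_sum, hsum]
            simp only [Finset.sum_const, Finset.card_univ, Fintype.card_fin, nsmul_eq_mul]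
            field_simp
            ring
    set v := ‖x - p‖⁻¹ • (x - p) with hv
    have hv1 : ‖v‖ = 1 := by
      rw [hv, norm_smul, norm_inv, norm_norm, inv_mul_cancel₀ hnorm.ne']
    have hinv : inner ℝ (x - p) v ^ 2 = ρ := by
      rw [hv, real_inner_smul_right, real_inner_self_eq_norm_sq, hρdef]
      field_simp
    have hhess : hess2 φ x v ≤
        φ x * ((4 * (z ^ 2 + γ * z * (1 - z) - z) + 2 * z) / ρ) := by
      have := (hcond v hv1).2
      rw [hinv, ← hz] at this
      refine this.trans_eq ?_
      field_simp
      ring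
    have h0 := hS x v hv1
    have hF := hpos x
    have h1 := mul_le_mul_of_nonneg_left hhess
      (mul_nonneg (by linarith : (0 : ℝ) ≤ n - 2) hF.le)
    have h2 := mul_le_mul_of_nonneg_left hlapl
      (mul_nonneg (by linarith : (0 : ℝ) ≤ 1 - τ) hF.le)
    have h3 : 0 ≤ φ x ^ 2 / ρ * (z * (1 - z)) * (4 * γ * (n - 1 - τ) - 2 * τ * (n - 2)) := by
      refine (h0.trans (sub_le_sub_right (add_le_add h1 h2) _)).trans_eq ?_
      rw [hgrad]
      field_simp
      ring
    have h4 : 0 < φ x ^ 2 / ρ * (z * (1 - z)) :=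
      mul_pos (by positivity) (mul_pos hz0 (by linarith))
    nlinarith [mul_pos h4 (by linarith : 0 < 2 * τ * (n - 2) - 4 * γ * (n - 1 - τ))]
  set D : EuclideanSpace ℝ (Fin n) → ℝ := fun y => Real.log (φ y) - G (‖y - p‖ ^ 2) with hD
  have hDq : 0 < D q := by
    have h1 : Real.log (1 + b * (‖q - p‖ ^ 2) ^ γ) ≤ γ * δ / 4 := by
      have h2 : b * (‖q - p‖ ^ 2) ^ γ = γ * δ / 4 := by
        rw [hb]
        field_simp
      rw [h2]
      have := Real.log_le_sub_one_of_pos (show 0 < 1 + γ * δ / 4 by positivity)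
      linarith
    have h3 : 1 / γ * Real.log (1 + b * (‖q - p‖ ^ 2) ^ γ) ≤ 1 / γ * (γ * δ / 4) := by gcongr
    have h4 : 1 / γ * (γ * δ / 4) = δ / 4 := by field_simp
    simp only [hD, hG, hC]
    linarith
  have hDp : D p < 0 := by
    simp [hD, hG, hC, Real.zero_rpow hγ0.ne']
    exact hδ0
  have hDcont : Continuous D := by
    have h1 : Continuous fun y => Real.log (φ y) := hφ.continuous.log fun y => (hpos y).ne'
    have h2 : Continuous fun y : EuclideanSpace ℝ (Fin n) => (‖y - p‖ ^ 2) ^ γ :=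
      (by fun_prop : Continuous fun y : EuclideanSpace ℝ (Fin n) => ‖y - p‖ ^ 2).rpow_const
        fun _ => Or.inr hγ0.le
    refine h1.sub (continuous_const.add (continuous_const.mul (Continuous.log ?_ fun y => ?_)))
    · fun_prop
    · have : 0 ≤ b * (‖y - p‖ ^ 2) ^ γ := by positivity
      linarith
  refine ⟨φ p * b ^ (1 / γ), mul_pos (hpos p) (by positivity), fun R hR => ?_⟩
  obtain ⟨x, hxmem, hxmax⟩ := (isCompact_closedBall p R).exists_isMaxOn
    ⟨p, Metric.mem_closedBall_self (hqp.le.trans hR.le)⟩ hDcont.continuousOn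
  rw [Metric.mem_closedBall, dist_eq_norm] at hxmem
  have hDx : 0 < D x := hDq.trans_le (hxmax (by
    rw [Metric.mem_closedBall, dist_eq_norm]; exact hR.le))
  have hxp : x ≠ p := fun h => by rw [h] at hDx; linarith
  have hxR : ‖x - p‖ = R := by
    refine le_antisymm hxmem (not_lt.mp fun hlt => hno x hxp ?_)
    refine hxmax.isLocalMax (Metric.closedBall_mem_nhds_of_mem ?_)
    rwa [Metric.mem_ball, dist_eq_norm]
  refine ⟨x, hxR, ?_⟩
  have hRpos : 0 < R := hqp.trans hR
  have h1 : Real.log (φ p) + 1 / γ * Real.log (b * (R ^ 2) ^ γ) ≤ Real.log (φ x) := by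
    have h2 : Real.log (b * (R ^ 2) ^ γ) ≤ Real.log (1 + b * (R ^ 2) ^ γ) :=
      Real.log_le_log (by positivity) (by linarith)
    have h3 : 1 / γ * Real.log (b * (R ^ 2) ^ γ) ≤ 1 / γ * Real.log (1 + b * (R ^ 2) ^ γ) := by
      gcongr
    simp only [hD, hG, hC, hxR] at hDx
    linarith
  refine (Real.log_le_log_iff (mul_pos (mul_pos (hpos p) (by positivity)) (by positivity))
    (hpos x)).mp (le_of_eq_of_le ?_ h1)
  have hp := hpos p
  rw [Real.log_mul (by positivity) (by positivity), Real.log_mul (by positivity) (by positivity),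
    Real.log_mul (by positivity) (by positivity), Real.log_rpow (by positivity),
    Real.log_rpow (by positivity)]
  field_simp
  ring

/-- If `φ Δφ ≥ (3/2) |∇φ|²` then `u = φ ^ (-1/4)` satisfies `u Δu + |∇u|² ≤ 0`. -/
lemma lapl_rpow_mul_add_le {n : ℕ} {φ : EuclideanSpace ℝ (Fin n) → ℝ} (hφ : ContDiff ℝ 2 φ)
    (hpos : ∀ x, 0 < φ x) (hL : ∀ x, 3 / 2 * ‖gradient φ x‖ ^ 2 ≤ φ x * lapl φ x)
    (x : EuclideanSpace ℝ (Fin n)) :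
    lapl (fun y => φ y ^ (-(1 / 4) : ℝ)) x * φ x ^ (-(1 / 4) : ℝ)
      + ‖fderiv ℝ (fun y => φ y ^ (-(1 / 4) : ℝ)) x‖ ^ 2 ≤ 0 := by
  have hg : ∀ a s : ℝ, 0 < s → HasDerivAt (fun s : ℝ => s ^ a) (a * s ^ (a - 1)) s :=
    fun a s hs => Real.hasDerivAt_rpow_const (Or.inl hs.ne')
  have hd : fderiv ℝ (fun y => φ y ^ (-(1 / 4) : ℝ)) x
      = (-(1 / 4) * φ x ^ (-(1 / 4) - 1 : ℝ)) • fderiv ℝ φ x :=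
    ((hg _ _ (hpos x)).comp_hasFDerivAt x
      (hφ.differentiable (by norm_num) x).hasFDerivAt).fderiv
  have hlapl : lapl (fun y => φ y ^ (-(1 / 4) : ℝ)) x
      = (-(1 / 4) * ((-(1 / 4) - 1) * φ x ^ (-(1 / 4) - 1 - 1 : ℝ))) * ‖gradient φ x‖ ^ 2
        + (-(1 / 4) * φ x ^ (-(1 / 4) - 1 : ℝ)) * lapl φ x := by
    unfold lapl
    rw [← sum_fderiv_single_sq, Finset.mul_sum, Finset.mul_sum, ← Finset.sum_add_distrib]
    refine Finset.sum_congr rfl fun i _ => ?_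
    exact hess2_comp hφ (g' := fun s => -(1 / 4) * s ^ (-(1 / 4) - 1 : ℝ))
      (g'' := fun s => -(1 / 4) * ((-(1 / 4) - 1) * s ^ (-(1 / 4) - 1 - 1 : ℝ)))
      (fun y => hg _ _ (hpos y)) (fun y => (hg _ _ (hpos y)).const_mul _) x _
  have hx := hpos x
  rw [hd, hlapl, norm_smul, ← norm_gradient_eq, Real.rpow_sub_one hx.ne', Real.rpow_sub_one hx.ne',
    mul_pow, Real.norm_eq_abs, sq_abs]
  set w := φ x ^ (-(1 / 4) : ℝ)
  have h : (-(1 / 4) * ((-(1 / 4) - 1) * (w / φ x / φ x)) * ‖gradient φ x‖ ^ 2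
      + -(1 / 4) * (w / φ x) * lapl φ x) * w + (-(1 / 4) * (w / φ x)) ^ 2 * ‖gradient φ x‖ ^ 2
      = 1 / 4 * (w / φ x) ^ 2 * (3 / 2 * ‖gradient φ x‖ ^ 2 - φ x * lapl φ x) := by
    field_simp
    ring
  rw [h]
  exact mul_nonpos_of_nonneg_of_nonpos (by positivity) (by linarith [hL x])

/-- Along almost every ray the function `s ^ 2 * u (p + s ^ 6 • v)` is bounded, if `u` decays like
`R ^ (-1/2)` at one point of each sphere of radius `R` about `p`. -/
lemma exists_ray_decay {n : ℕ} {u : EuclideanSpace ℝ (Fin n) → ℝ} (hu : ContDiff ℝ 2 u)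
    (hpos : ∀ x, 0 < u x) (hΔ : ∀ x, lapl u x * u x + ‖fderiv ℝ u x‖ ^ 2 ≤ 0)
    {p : EuclideanSpace ℝ (Fin n)} {K S : ℝ} (hS : 1 ≤ S)
    (hdecay : ∀ s, S < s → ∃ x, ‖x - p‖ = s ^ 6 ∧ u x ≤ K / s ^ 3) :
    ∃ v : EuclideanSpace ℝ (Fin n), ∃ M, ∀ s, S ≤ s → s ^ 2 * u (p + s ^ 6 • v) ≤ M := by
  set B : Set (EuclideanSpace ℝ (Fin n)) := Metric.closedBall 0 1 with hB
  set A : ℝ := 400 * volume.real (Metric.closedBall (0 : EuclideanSpace ℝ (Fin n)) 5) with hA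
  have hA0 : 0 ≤ A := by positivity
  have hdu : Continuous (fderiv ℝ u) := hu.continuous_fderiv (by norm_num)
  set H : ℝ → EuclideanSpace ℝ (Fin n) → ℝ := fun s v =>
    2 * s * u (p + s ^ 6 • v) + s ^ 2 * (6 * s ^ 5 * fderiv ℝ u (p + s ^ 6 • v) v) with hH
  have hHcont : Continuous fun z : EuclideanSpace ℝ (Fin n) × ℝ => H z.2 z.1 := by
    have h1 : Continuous fun z : EuclideanSpace ℝ (Fin n) × ℝ => p + z.2 ^ 6 • z.1 := by fun_prop
    have h2 := hu.continuous.comp h1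
    have h3 : Continuous fun z : EuclideanSpace ℝ (Fin n) × ℝ =>
        fderiv ℝ u (p + z.2 ^ 6 • z.1) z.1 := (hdu.comp h1).clm_apply continuous_fst
    simp only [hH]
    exact (Continuous.mul (by fun_prop) h2).add
      (Continuous.mul (by fun_prop) (Continuous.mul (by fun_prop) h3))
  have hderiv : ∀ v s, HasDerivAt (fun s : ℝ => s ^ 2 * u (p + s ^ 6 • v)) (H s v) s := by
    intro v s
    have h1 : HasDerivAt (fun s : ℝ => p + s ^ 6 • v) ((6 * s ^ 5) • v) s := by
      refine (((hasDerivAt_pow 6 s).smul_const v).const_add p).congr_deriv ?_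
      simp
    have h2 := (hu.differentiable (by norm_num) _).hasFDerivAt.comp_hasDerivAt s h1
    refine ((hasDerivAt_pow 2 s).mul h2).congr_deriv ?_
    simp [hH]
  have hslice : ∀ s ∈ Ioi S, ∫⁻ v in B, ‖H s v‖ₑ ≤ ENNReal.ofReal (6 * A * K * s ^ (-2 : ℝ)) := by
    intro s hs
    have hs0 : 0 < s := by linarith [mem_Ioi.mp hs]
    obtain ⟨x, hx, hxK⟩ := hdecay s hs
    set U : EuclideanSpace ℝ (Fin n) → ℝ := fun v => u (p + s ^ 6 • v) with hU
    have hUc : ContDiff ℝ 2 U := hu.comp (by fun_prop)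
    have hdU : ∀ v w, fderiv ℝ U v w = s ^ 6 * fderiv ℝ u (p + s ^ 6 • v) w := fun v w =>
      fderiv_comp_affine (hu.differentiable (by norm_num)) p (s ^ 6) v w
    have hdU' : ∀ v, fderiv ℝ U v = s ^ 6 • fderiv ℝ u (p + s ^ 6 • v) := fun v => by
      ext w
      simp [hdU]
    have hUΔ : ∀ v, lapl U v * U v + ‖fderiv ℝ U v‖ ^ 2 ≤ 0 := by
      intro v
      rw [hdU', hU, lapl_comp_affine hu, norm_smul, mul_pow, Real.norm_eq_abs, sq_abs]
      have := mul_nonpos_of_nonneg_of_nonpos (sq_nonneg (s ^ 6)) (hΔ (p + s ^ 6 • v))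
      linarith
    have hxe : p + s ^ 6 • ((s ^ 6)⁻¹ • (x - p)) = x := by
      rw [smul_inv_smul₀ (by positivity)]
      abel
    have hest := setIntegral_add_norm_fderiv_le (e := (s ^ 6)⁻¹ • (x - p))
      (by
        rw [norm_smul, hx, norm_inv, Real.norm_of_nonneg (by positivity),
          inv_mul_cancel₀ (by positivity)]) hUc (fun v => hpos _) hUΔ
    have hUe : U ((s ^ 6)⁻¹ • (x - p)) = u x := by rw [hU]; simp only [hxe]
    rw [hUe] at hest
    have hdUc : Continuous (fderiv ℝ U) := hUc.continuous_fderiv (by norm_num)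
    have hint : IntegrableOn (fun v => 6 * s * (U v + ‖fderiv ℝ U v‖)) B :=
      (continuous_const.mul (hUc.continuous.add hdUc.norm)).continuousOn.integrableOn_compact
        (isCompact_closedBall _ _)
    calc ∫⁻ v in B, ‖H s v‖ₑ
        ≤ ∫⁻ v in B, ENNReal.ofReal (6 * s * (U v + ‖fderiv ℝ U v‖)) := by
          refine setLIntegral_mono' measurableSet_closedBall fun v hv => ?_
          rw [Real.enorm_eq_ofReal_abs]
          refine ENNReal.ofReal_le_ofReal ?_
          rw [hB, Metric.mem_closedBall, dist_zero_right] at hv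
          have h1 : |fderiv ℝ U v v| ≤ ‖fderiv ℝ U v‖ := by
            rw [← Real.norm_eq_abs]
            exact ((fderiv ℝ U v).le_opNorm v).trans (mul_le_of_le_one_right (norm_nonneg _) hv)
          have h2 : H s v = 2 * s * U v + 6 * s * fderiv ℝ U v v := by
            rw [hdU]
            simp only [hH, hU]
            ring
          have h3 : 0 < U v := hpos _
          rw [h2]
          refine (abs_add_le _ _).trans ?_
          rw [abs_of_pos (show 0 < 2 * s * U v by positivity), abs_mul,
            abs_of_pos (show 0 < 6 * s by positivity)]
          nlinarith [mul_pos hs0 h3, mul_le_mul_of_nonneg_left h1 hs0.le]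
      _ = ENNReal.ofReal (∫ v in B, 6 * s * (U v + ‖fderiv ℝ U v‖)) := by
          rw [ofReal_integral_eq_lintegral_ofReal hint]
          refine Eventually.of_forall fun v => ?_
          have : 0 < U v := hpos _
          simp only [Pi.zero_apply]
          positivity
      _ ≤ _ := by
          refine ENNReal.ofReal_le_ofReal ?_
          rw [integral_const_mul, Real.rpow_neg hs0.le, Real.rpow_two]
          calc 6 * s * ∫ v in B, (U v + ‖fderiv ℝ U v‖) ≤ 6 * s * (A * (K / s ^ 3)) := by
                refine mul_le_mul_of_nonneg_left (hest.trans ?_) (by positivity)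
                exact mul_le_mul_of_nonneg_left hxK hA0
            _ = _ := by field_simp
  have hfin : ∫⁻ v in B, ∫⁻ s in Ioi S, ‖H s v‖ₑ < ⊤ := by
    rw [lintegral_lintegral_swap hHcont.measurable.enorm.aemeasurable]
    refine (setLIntegral_mono' measurableSet_Ioi hslice).trans_lt ?_
    have : IntegrableOn (fun s : ℝ => 6 * A * K * s ^ (-2 : ℝ)) (Ioi S) :=
      (integrableOn_Ioi_rpow_of_lt (by norm_num) (by linarith)).const_mul _
    exact this.lintegral_lt_top
  have hmeas : Measurable fun v => ∫⁻ s in Ioi S, ‖H s v‖ₑ :=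
    (hHcont.measurable.enorm).lintegral_prod_right'
  have hae := ae_lt_top hmeas hfin.ne
  have hvol : volume.restrict B ≠ 0 := by
    rw [Ne, Measure.restrict_eq_zero]
    exact (Metric.measure_closedBall_pos volume _ one_pos).ne'
  have : (ae (volume.restrict B)).NeBot := ae_neBot.mpr hvol
  obtain ⟨v, hv⟩ := hae.exists
  have hHv : Continuous fun s => H s v := hHcont.comp (by fun_prop : Continuous fun s : ℝ => (v, s))
  have hHint : IntegrableOn (fun s => H s v) (Ioi S) := ⟨hHv.aestronglyMeasurable, hv⟩
  refine ⟨v, S ^ 2 * u (p + S ^ 6 • v) + ∫ s in Ioi S, ‖H s v‖, fun s hs => ?_⟩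
  have hFTC := intervalIntegral.integral_eq_sub_of_hasDerivAt (a := S) (b := s)
    (fun r _ => hderiv v r) (hHv.intervalIntegrable _ _)
  have h1 : ∫ r in S..s, H r v ≤ ∫ r in Ioi S, ‖H r v‖ := by
    rw [intervalIntegral.integral_of_le hs]
    calc ∫ r in Ioc S s, H r v ≤ ∫ r in Ioc S s, ‖H r v‖ :=
          (Real.le_norm_self _).trans (norm_integral_le_integral_norm _)
      _ ≤ ∫ r in Ioi S, ‖H r v‖ :=
          setIntegral_mono_set hHint.norm (Eventually.of_forall fun r => norm_nonneg _)
            Ioc_subset_Ioi_self.eventuallyLE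
  linarith

/-- The conclusion for `τ ≤ 1`. -/
lemma le_of_schouten_nonneg {n : ℕ} (hn : 3 ≤ n) {τ : ℝ} (hτ0 : 0 < τ) (hτ1 : τ ≤ 1)
    {φ : EuclideanSpace ℝ (Fin n) → ℝ} (hφ : ContDiff ℝ 2 φ) (hpos : ∀ x, 0 < φ x)
    (hcomplete : ∀ γ : ℝ → EuclideanSpace ℝ (Fin n), ContDiff ℝ 1 γ →
      Tendsto (fun t => ‖γ t‖) atTop atTop →
      ∫⁻ t in Ioi (0 : ℝ), ENNReal.ofReal ((φ (γ t))⁻¹ * ‖deriv γ t‖) = ⊤)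
    (hS : ∀ x v : EuclideanSpace ℝ (Fin n), ‖v‖ = 1 →
      0 ≤ (n - 2) * φ x * hess2 φ x v + (1 - τ) * φ x * lapl φ x
        - (n - 1 - τ * n / 2) * ‖gradient φ x‖ ^ 2)
    (hL : ∀ x, 3 / 2 * ‖gradient φ x‖ ^ 2 ≤ φ x * lapl φ x)
    (p q : EuclideanSpace ℝ (Fin n)) : φ q ≤ φ p := by
  by_contra! hpq
  obtain ⟨c, hc, hgrow⟩ := exists_sphere_quadratic_growth hn hτ0 hτ1 hφ hpos hS hpq
  set u : EuclideanSpace ℝ (Fin n) → ℝ := fun y => φ y ^ (-(1 / 4) : ℝ) with hu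
  have hupos : ∀ x, 0 < u x := fun x => Real.rpow_pos_of_pos (hpos x) _
  have hu4 : ∀ x, u x ^ 4 = (φ x)⁻¹ := by
    intro x
    rw [hu, ← Real.rpow_natCast, ← Real.rpow_mul (hpos x).le, ← Real.rpow_neg_one]
    norm_num
  have huc : ContDiff ℝ 2 u := hφ.rpow_const_of_ne fun x => (hpos x).ne'
  set S : ℝ := ‖q - p‖ + 1 with hSdef
  have hS1 : 1 ≤ S := by linarith [norm_nonneg (q - p)]
  obtain ⟨v, M, hM⟩ := exists_ray_decay huc hupos (lapl_rpow_mul_add_le hφ hpos hL) (p := p)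
    (K := c ^ (-(1 / 4) : ℝ)) hS1 (by
      intro s hs
      have hs1 : 1 < s := by linarith
      have hs0 : 0 < s := by linarith
      obtain ⟨x, hx, hcx⟩ := hgrow (s ^ 6) (by
        have := le_self_pow₀ hs1.le (show 6 ≠ 0 by norm_num)
        linarith)
      refine ⟨x, hx, ?_⟩
      refine (Real.rpow_le_rpow_of_nonpos (by positivity) hcx (by norm_num)).trans_eq ?_
      rw [Real.mul_rpow hc.le (by positivity), div_eq_mul_inv, ← pow_mul]
      congr 1
      rw [← Real.rpow_natCast, ← Real.rpow_natCast, ← Real.rpow_mul hs0.le, ← Real.rpow_neg hs0.le]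
      norm_num)
  have hM0 : 0 < M := lt_of_lt_of_le (mul_pos (by positivity) (hupos _)) (hM S le_rfl)
  have hv : v ≠ 0 := by
    rintro rfl
    have hu0 := hupos p
    have hmax : S ≤ max S (M / u p + 1) := le_max_left _ _
    have h := hM _ hmax
    simp only [smul_zero, add_zero] at h
    have h1 : M / u p < max S (M / u p + 1) := lt_of_lt_of_le (by linarith) (le_max_right _ _)
    rw [div_lt_iff₀ hu0] at h1
    have h2 := le_self_pow₀ (hS1.trans hmax) two_ne_zero
    nlinarith [mul_le_mul_of_nonneg_right h2 hu0.le]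
  set γ : ℝ → EuclideanSpace ℝ (Fin n) := fun s => p + s ^ 6 • v with hγ
  have hγc : ContDiff ℝ 1 γ := by
    rw [hγ]
    fun_prop
  have hγd : ∀ s, deriv γ s = (6 * s ^ 5) • v := fun s => by
    have : HasDerivAt γ ((6 * s ^ 5) • v) s := by
      refine (((hasDerivAt_pow 6 s).smul_const v).const_add p).congr_deriv ?_
      simp
    exact this.deriv
  have hγt : Tendsto (fun t => ‖γ t‖) atTop atTop := by
    have h1 : Tendsto (fun s : ℝ => s ^ 6 * ‖v‖ - ‖p‖) atTop atTop :=
      tendsto_atTop_add_const_right _ _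
        ((tendsto_pow_atTop (by norm_num)).atTop_mul_const (norm_pos_iff.mpr hv))
    refine tendsto_atTop_mono (fun s => ?_) h1
    have h2 := norm_sub_norm_le (s ^ 6 • v) (-p)
    rw [norm_smul, norm_neg, sub_neg_eq_add, norm_pow, Real.norm_eq_abs, Even.pow_abs (by decide),
      add_comm] at h2
    exact h2
  refine (lt_top_iff_ne_top.mp ?_) (hcomplete γ hγc hγt)
  have hcont : Continuous fun s => (φ (γ s))⁻¹ * ‖deriv γ s‖ := by
    refine ((hφ.continuous.comp hγc.continuous).inv₀ fun s => (hpos _).ne').mul ?_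
    exact (hγc.continuous_deriv le_rfl).norm
  have hint : IntegrableOn (fun s => (φ (γ s))⁻¹ * ‖deriv γ s‖) (Ioi S) := by
    have hdom : IntegrableOn (fun s : ℝ => M ^ 4 * (6 * ‖v‖) * s ^ (-3 : ℝ)) (Ioi S) :=
      (integrableOn_Ioi_rpow_of_lt (by norm_num) (by linarith)).const_mul _
    refine Integrable.mono' hdom hcont.aestronglyMeasurable ?_
    refine (ae_restrict_iff' measurableSet_Ioi).mpr (Eventually.of_forall fun s hs => ?_)
    have hs0 : 0 < s := by linarith [mem_Ioi.mp hs]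
    have h1 : (s ^ 2 * u (γ s)) ^ 4 ≤ M ^ 4 :=
      pow_le_pow_left₀ (mul_nonneg (by positivity) (hupos _).le) (hM s (mem_Ioi.mp hs).le) 4
    rw [mul_pow, hu4] at h1
    have h2 : 0 < (φ (γ s))⁻¹ := inv_pos.mpr (hpos _)
    rw [hγd, norm_smul, Real.norm_of_nonneg (by positivity), Real.norm_of_nonneg (by positivity),
      Real.rpow_neg hs0.le, show (3 : ℝ) = (3 : ℕ) by norm_num, Real.rpow_natCast]
    calc (φ (γ s))⁻¹ * (6 * s ^ 5 * ‖v‖)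
        = ((s ^ 2) ^ 4 * (φ (γ s))⁻¹) * (6 * ‖v‖) * (s ^ 3)⁻¹ := by
          field_simp
      _ ≤ _ := by gcongr
  have hint' : IntegrableOn (fun s => (φ (γ s))⁻¹ * ‖deriv γ s‖) (Ioi 0) := by
    rw [← Ioc_union_Ioi_eq_Ioi (show (0 : ℝ) ≤ S by linarith)]
    exact ((hcont.continuousOn.integrableOn_compact isCompact_Icc).mono_set
      Ioc_subset_Icc_self).union hint
  exact hint'.lintegral_lt_top

/-- Rigidity of conformal metrics on `ℝⁿ` with nonnegative
modified Schouten tensor. -/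
theorem stmt0 {n : ℕ} (hn : 3 ≤ n) (τ : ℝ) (hτ0 : 0 < τ) (hτ1 : τ < 2 * (n - 1) / n)
    (φ : EuclideanSpace ℝ (Fin n) → ℝ) (hφ : ContDiff ℝ (⊤ : ℕ∞) φ) (hφpos : ∀ x, 0 < φ x)
    -- completeness of `g = φ⁻² g₀` : every divergent `C¹` curve has infinite `g`-length
    (hcomplete : ∀ γ : ℝ → EuclideanSpace ℝ (Fin n), ContDiff ℝ 1 γ →
      Tendsto (fun t => ‖γ t‖) atTop atTop →
      ∫⁻ t in Ioi (0 : ℝ), ENNReal.ofReal ((φ (γ t))⁻¹ * ‖deriv γ t‖) = ⊤)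
    -- nonnegativity of the modified Schouten tensor `A^τ_g ≥ 0`
    (hSchouten : ∀ x v : EuclideanSpace ℝ (Fin n), ‖v‖ = 1 →
      0 ≤ (n - 2) * φ x * hess2 φ x v + (1 - τ) * φ x * lapl φ x
        - (n - 1 - τ * n / 2) * ‖gradient φ x‖ ^ 2) :
    ∃ c : ℝ, ∀ x, φ x = c := by
  have hn' : (3 : ℝ) ≤ n := by exact_mod_cast hn
  have hφ2 : ContDiff ℝ 2 φ := contDiff_infty.mp hφ 2
  have hc : 0 < (n : ℝ) - 1 - τ * n / 2 := by
    rw [lt_div_iff₀ (by linarith)] at hτ1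
    linarith
  have htrace : ∀ x, n / 2 * ‖gradient φ x‖ ^ 2 ≤ φ x * lapl φ x := by
    intro x
    have h := Finset.sum_nonneg fun (i : Fin n) (_ : i ∈ Finset.univ) =>
      hSchouten x (EuclideanSpace.single i 1) (by simp)
    rw [Finset.sum_sub_distrib, Finset.sum_add_distrib, ← Finset.mul_sum] at h
    simp only [Finset.sum_const, Finset.card_univ, Fintype.card_fin, nsmul_eq_mul] at h
    have hl : ∑ i : Fin n, hess2 φ x (EuclideanSpace.single i 1) = lapl φ x := rfl
    rw [hl] at h
    have h1 : 0 ≤ (n - 1 - τ * n / 2) * (φ x * lapl φ x - n / 2 * ‖gradient φ x‖ ^ 2) := by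
      linarith
    linarith [nonneg_of_mul_nonneg_right h1 hc]
  have hL : ∀ x, 3 / 2 * ‖gradient φ x‖ ^ 2 ≤ φ x * lapl φ x := fun x =>
    (mul_le_mul_of_nonneg_right (by linarith) (sq_nonneg _)).trans (htrace x)
  have hle : ∀ p q, φ q ≤ φ p := by
    rcases le_total τ 1 with h | h
    · exact le_of_schouten_nonneg hn hτ0 h hφ2 hφpos hcomplete hSchouten hL
    · refine le_of_schouten_nonneg hn one_pos le_rfl hφ2 hφpos hcomplete (fun x v hv => ?_) hL
      have h1 := mul_le_mul_of_nonneg_left (htrace x) (sub_nonneg.mpr h)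
      linarith [hSchouten x v hv]
  exact ⟨φ 0, fun x => le_antisymm (hle 0 x) (hle x 0)⟩
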